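/- For every non-decreasing function δ: (0,1) → (0,1) there exist a surjective four-valent symbol ψ: D → D (i.e. ψ(D) = D and every w ∈ D has at most four ψ-preimages) and a number h₀ ∈ (0,1) such that m({z ∈ T : |ψ*(z)| ≥ 1 − h}) ≤ δ(h) for all 0 < h ≤ h₀. -/

import Mathlib

open Complex MeasureTheory Set Filter
open scoped ENNReal Topology

noncomputable section

/-- The open unit disk in `ℂ`. -/
def unitDisk : Set ℂ := Metric.ball (0 : ℂ) 1

/-- A symbol: a non-constant analytic self-map of the unit disk. -/
structure IsSymbol (φ : ℂ → ℂ) : Prop where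
  mapsTo : Set.MapsTo φ unitDisk unitDisk
  diff : DifferentiableOn ℂ φ unitDisk
  nonconst : ¬ ∃ c : ℂ, Set.EqOn φ (fun _ => c) unitDisk

/-- `φ` is `p`-valent: every `w ∈ 𝔻` has at most `p` preimages in `𝔻`. -/
def Valent (φ : ℂ → ℂ) (p : ℕ) : Prop :=
  ∀ w ∈ unitDisk, (unitDisk ∩ φ ⁻¹' {w}).encard ≤ p

/-- The radial limit of `φ` at the boundary point `toCircle θ` exists and equals `w`.
The circle `𝕋` is parametrized by `AddCircle 1` (so that `volume` is the normalized
Haar measure `m`). -/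
def HasRadialLimit (φ : ℂ → ℂ) (θ : AddCircle (1 : ℝ)) (w : ℂ) : Prop :=
  Filter.Tendsto (fun r : ℝ => φ (r * (AddCircle.toCircle θ : ℂ)))
    (nhdsWithin 1 (Set.Iio 1)) (nhds w)

/-- The pull-back measure `m_φ(S) = m({ξ : φ*(ξ) ∈ S})`. -/
def pullbackMeasure (φ : ℂ → ℂ) (S : Set ℂ) : ℝ≥0∞ :=
  volume {θ : AddCircle (1 : ℝ) | ∃ w ∈ S, HasRadialLimit φ θ w}

/-- `ρ_φ(h) = sup_{ξ ∈ 𝕋} m_φ[S(ξ,h)]`, where `S(ξ,h) = {z : |z - ξ| ≤ h}`. -/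
def rho (φ : ℂ → ℂ) (h : ℝ) : ℝ≥0∞ :=
  ⨆ ξ : Circle, pullbackMeasure φ {z : ℂ | ‖z - (ξ : ℂ)‖ ≤ h}

/-- The `n`-th approximation number of a bounded operator between normed spaces:
the distance of `T` to operators of rank `< n`. -/
def approxNum {E F : Type*} [NormedAddCommGroup E] [NormedAddCommGroup F]
    [NormedSpace ℂ E] [NormedSpace ℂ F] (n : ℕ) (T : E →L[ℂ] F) : ℝ :=
  sInf {c : ℝ | ∃ R : E →L[ℂ] F,
    Module.rank ℂ (LinearMap.range (R : E →ₗ[ℂ] F)) < (n : Cardinal) ∧ c = ‖T - R‖}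

/-- The Hardy space `H²(𝔻)` in its coefficient model `ℓ²(ℕ)`. -/
abbrev H2 := lp (fun _ : ℕ => ℂ) 2

/-- The analytic function on `𝔻` associated with an element of `H²`. -/
def H2.eval (a : H2) (z : ℂ) : ℂ := ∑' n : ℕ, a n * z ^ n

/-- `T` is the composition operator with symbol `φ` on `H²(𝔻)`. -/
def IsCompOp (φ : ℂ → ℂ) (T : H2 →L[ℂ] H2) : Prop :=
  ∀ a : H2, ∀ z ∈ unitDisk, H2.eval (T a) z = H2.eval a (φ z)

/-- The open unit polydisk `𝔻^N`. -/
def polyDisk (N : ℕ) : Set (Fin N → ℂ) := {z | ∀ i, ‖z i‖ < 1}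

/-- The Hardy space `H²(𝔻^N)` in its coefficient model `ℓ²(ℕ^N)`. -/
abbrev H2poly (N : ℕ) := lp (fun _ : Fin N → ℕ => ℂ) 2

/-- The analytic function on `𝔻^N` associated with an element of `H²(𝔻^N)`. -/
def H2poly.eval {N : ℕ} (a : H2poly N) (z : Fin N → ℂ) : ℂ :=
  ∑' α : Fin N → ℕ, a α * ∏ i, z i ^ α i

/-- `T` is the composition operator with symbol `Φ` on `H²(𝔻^N)`. -/
def IsCompOpPoly {N : ℕ} (Φ : (Fin N → ℂ) → (Fin N → ℂ))
    (T : H2poly N →L[ℂ] H2poly N) : Prop :=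
  ∀ a : H2poly N, ∀ z ∈ polyDisk N, H2poly.eval (T a) z = H2poly.eval a (Φ z)

/-- The lens map `λ_θ`. -/
def lens (θ : ℝ) (z : ℂ) : ℂ :=
  ((1 + z) ^ (θ : ℂ) - (1 - z) ^ (θ : ℂ)) / ((1 + z) ^ (θ : ℂ) + (1 - z) ^ (θ : ℂ))

/-- A function with nonnegative derivative on `(a, ∞)` is monotone there. -/
theorem monotoneOn_Ioi_of_hasDerivAt {f f' : ℝ → ℝ} {a : ℝ}
    (hf : ∀ s, a < s → HasDerivAt f (f' s) s) (hf' : ∀ s, a < s → 0 ≤ f' s) :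
    MonotoneOn f (Ioi a) := by
  refine monotoneOn_of_deriv_nonneg (convex_Ioi a)
    (fun s hs => (hf s hs).continuousAt.continuousWithinAt) ?_ ?_
  · intro s hs
    rw [interior_Ioi] at hs
    exact (hf s hs).differentiableAt.differentiableWithinAt
  · intro s hs
    rw [interior_Ioi] at hs
    rw [(hf s hs).deriv]
    exact hf' s hs

/-- A holomorphic map `F` of a half-plane, with speed `V` (equal to `v` on the real axis) and
real-axis coordinates `X + iY`, whose image is a slowly narrowing, nearly vertical band. -/
structure IsSlowSpiral (V F : ℂ → ℂ) (v X Y : ℝ → ℝ) : Prop where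
  hasDerivAt : ∀ ζ : ℂ, -5 < ζ.re → HasDerivAt F (I * V ζ - (3 / 8) * V ζ ^ 2) ζ
  eq_real : ∀ s : ℝ, F s = X s + Y s * I
  pos : ∀ s, -1 < s → 0 < v s
  le_small : ∀ s, -1 < s → v s ≤ 1 / 100
  approx : ∀ s : ℝ, -1 < s → ∀ ζ : ℂ, ‖ζ - s‖ ≤ 2 → ‖V ζ - v s‖ ≤ v s / 100
  hasDerivAt_X : ∀ s, -1 < s → HasDerivAt X (-(3 / 8) * v s ^ 2) s
  hasDerivAt_Y : ∀ s, -1 < s → HasDerivAt Y (v s) s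
  exists_deriv : ∃ v' : ℝ → ℝ, ∀ s, -1 < s →
    HasDerivAt v (v' s) s ∧ v' s ≤ 0 ∧ -(v s ^ 2 / 100) ≤ v' s
  tendsto_X : Tendsto X atTop (𝓝 0)
  tendsto_Y : Tendsto Y atTop atTop
  tendsto_v : Tendsto v atTop (𝓝 0)

namespace IsSlowSpiral

variable {V F : ℂ → ℂ} {v X Y : ℝ → ℝ}

theorem v_anti (h : IsSlowSpiral V F v X Y) {s t : ℝ} (hs : -1 < s) (hst : s ≤ t) :
    v t ≤ v s := by
  obtain ⟨v', hv'⟩ := h.exists_deriv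
  have := monotoneOn_Ioi_of_hasDerivAt (f := fun s => -v s) (fun s hs => (hv' s hs).1.neg)
    (fun s hs => neg_nonneg.2 (hv' s hs).2.1) hs (hs.trans_le hst) hst
  simpa using this

theorem v_sub_le (h : IsSlowSpiral V F v X Y) {s t : ℝ} (hs : -1 < s) (hst : s ≤ t) :
    v s - v t ≤ 2 / 75 * (X s - X t) := by
  obtain ⟨v', hv'⟩ := h.exists_deriv
  have := monotoneOn_Ioi_of_hasDerivAt (f := fun s => v s - 2 / 75 * X s)
    (fun s hs => (hv' s hs).1.sub ((h.hasDerivAt_X s hs).const_mul (2 / 75)))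
    (fun s hs => by linarith [(hv' s hs).2.2]) hs (hs.trans_le hst) hst
  simp only at this
  linarith

theorem X_anti (h : IsSlowSpiral V F v X Y) {s t : ℝ} (hs : -1 < s) (hst : s ≤ t) :
    X t ≤ X s := by
  linarith [h.v_sub_le hs hst, h.v_anti hs hst]

theorem Y_mono (h : IsSlowSpiral V F v X Y) {s t : ℝ} (hs : -1 < s) (hst : s ≤ t) :
    Y s ≤ Y t :=
  monotoneOn_Ioi_of_hasDerivAt h.hasDerivAt_Y (fun s hs => (h.pos s hs).le) hs
    (hs.trans_le hst) hst

theorem le_X_sub (h : IsSlowSpiral V F v X Y) {s t : ℝ} (hs : -1 < s) (hst : s ≤ t) :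
    3 / 8 * v t * (Y t - Y s) ≤ X s - X t := by
  have hanti : AntitoneOn (fun r => X r + 3 / 8 * v t * Y r) (Icc s t) := by
    refine antitoneOn_of_hasDerivWithinAt_nonpos
      (f' := fun r => -(3 / 8) * v r ^ 2 + 3 / 8 * v t * v r) (convex_Icc s t) ?_ ?_ ?_
    · intro r hr
      have hr' : -1 < r := hs.trans_le hr.1
      exact ((h.hasDerivAt_X r hr').continuousAt.add
        (continuousAt_const.mul (h.hasDerivAt_Y r hr').continuousAt)).continuousWithinAt
    · intro r hr
      have hr' : -1 < r := hs.trans_le (interior_subset hr).1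
      exact ((h.hasDerivAt_X r hr').add
        ((h.hasDerivAt_Y r hr').const_mul _)).hasDerivWithinAt
    · intro r hr
      have hr' : -1 < r := hs.trans_le (interior_subset hr).1
      nlinarith [h.pos r hr', h.v_anti hr' (interior_subset hr).2]
  have := hanti (left_mem_Icc.2 hst) (right_mem_Icc.2 hst) hst
  simp only at this
  linarith

theorem X_sub_le (h : IsSlowSpiral V F v X Y) {s t : ℝ} (hs : -1 < s) (hst : s ≤ t) :
    X s - X t ≤ 3 / 8 * v s * (Y t - Y s) := by
  have hmono : MonotoneOn (fun r => X r + 3 / 8 * v s * Y r) (Icc s t) := by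
    refine monotoneOn_of_hasDerivWithinAt_nonneg
      (f' := fun r => -(3 / 8) * v r ^ 2 + 3 / 8 * v s * v r) (convex_Icc s t) ?_ ?_ ?_
    · intro r hr
      have hr' : -1 < r := hs.trans_le hr.1
      exact ((h.hasDerivAt_X r hr').continuousAt.add
        (continuousAt_const.mul (h.hasDerivAt_Y r hr').continuousAt)).continuousWithinAt
    · intro r hr
      have hr' : -1 < r := hs.trans_le (interior_subset hr).1
      exact ((h.hasDerivAt_X r hr').add
        ((h.hasDerivAt_Y r hr').const_mul _)).hasDerivWithinAt
    · intro r hr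
      have hr' : -1 < r := hs.trans_le (interior_subset hr).1
      nlinarith [h.pos r hr', h.v_anti hs (interior_subset hr).1]
  have := hmono (left_mem_Icc.2 hst) (right_mem_Icc.2 hst) hst
  simp only at this
  linarith

theorem v_le_X (h : IsSlowSpiral V F v X Y) {s : ℝ} (hs : -1 < s) : v s ≤ 2 / 75 * X s := by
  have h1 : Tendsto (fun t => 2 / 75 * (X s - X t) + v t) atTop
      (𝓝 (2 / 75 * (X s - 0) + 0)) :=
    ((tendsto_const_nhds.sub h.tendsto_X).const_mul _).add h.tendsto_v
  simp only [sub_zero, add_zero] at h1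
  refine ge_of_tendsto h1 ?_
  filter_upwards [eventually_ge_atTop s] with t ht
  linarith [h.v_sub_le hs ht]

theorem norm_deriv_sub_le (h : IsSlowSpiral V F v X Y) {s : ℝ} (hs : -1 < s) {ζ : ℂ}
    (hζ : ‖ζ - s‖ ≤ 2) : ‖I * V ζ - (3 / 8) * V ζ ^ 2 - I * v s‖ ≤ v s / 50 := by
  have ha := h.approx s hs ζ hζ
  have hp := h.pos s hs
  have hl := h.le_small s hs
  have hV : ‖V ζ‖ ≤ 101 / 100 * v s := by
    have h1 : ‖V ζ‖ ≤ ‖V ζ - v s‖ + ‖(v s : ℂ)‖ := norm_le_norm_sub_add _ _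
    rw [Complex.norm_real, Real.norm_of_nonneg hp.le] at h1
    linarith
  have e : I * V ζ - (3 / 8) * V ζ ^ 2 - I * v s = I * (V ζ - v s) - (3 / 8) * V ζ ^ 2 := by ring
  rw [e]
  refine (norm_sub_le _ _).trans ?_
  have e2 : ‖(3 / 8 : ℂ) * V ζ ^ 2‖ = 3 / 8 * ‖V ζ‖ ^ 2 := by
    rw [norm_mul, norm_pow]
    norm_num
  rw [e2, norm_mul, norm_I, one_mul]
  have h3 : ‖V ζ‖ ^ 2 ≤ (101 / 100 * v s) ^ 2 := by gcongr
  nlinarith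

theorem norm_sub_sub_le (h : IsSlowSpiral V F v X Y) {s : ℝ} (hs : -1 < s) {ζ ξ : ℂ}
    (hζ : ‖ζ - s‖ ≤ 2) (hξ : ‖ξ - s‖ ≤ 2) :
    ‖F ζ - F ξ - I * v s * (ζ - ξ)‖ ≤ v s / 50 * ‖ζ - ξ‖ := by
  have hd : ∀ x ∈ Metric.closedBall (s : ℂ) 2,
      HasDerivWithinAt (fun ζ => F ζ - I * v s * ζ)
        (I * V x - (3 / 8) * V x ^ 2 - I * v s) (Metric.closedBall (s : ℂ) 2) x := by
    intro x hx
    rw [mem_closedBall_iff_norm] at hx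
    have hre : -5 < x.re := by
      have := (abs_le.1 ((Complex.abs_re_le_norm (x - s)).trans hx)).1
      simp at this
      linarith
    exact (((h.hasDerivAt x hre).sub
      ((hasDerivAt_id x).const_mul (I * v s))).congr_deriv (by simp)).hasDerivWithinAt
  have := (convex_closedBall (s : ℂ) 2).norm_image_sub_le_of_norm_hasDerivWithin_le hd
    (fun x hx => h.norm_deriv_sub_le hs (mem_closedBall_iff_norm.1 hx))
    (mem_closedBall_iff_norm.2 hξ) (mem_closedBall_iff_norm.2 hζ)
  have e : F ζ - F ξ - I * v s * (ζ - ξ) = F ζ - I * v s * ζ - (F ξ - I * v s * ξ) := by ring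
  rw [e]
  exact this

theorem abs_coord_le (h : IsSlowSpiral V F v X Y) {ζ : ℂ} (hs : -1 < ζ.re)
    (hi : |ζ.im| ≤ 2) : |(F ζ).re - X ζ.re| ≤ 51 / 50 * v ζ.re * |ζ.im| ∧
      |(F ζ).im - Y ζ.re| ≤ v ζ.re / 50 * |ζ.im| := by
  have e : ζ - (ζ.re : ℂ) = ζ.im * I := by
    apply Complex.ext <;> simp
  have hn : ‖ζ - (ζ.re : ℂ)‖ = |ζ.im| := by rw [e]; simp
  have := h.norm_sub_sub_le hs (ζ := ζ) (ξ := ζ.re) (by rw [hn]; exact hi) (by simp)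
  rw [hn, e, h.eq_real] at this
  have h1 := (Complex.abs_re_le_norm _).trans this
  have h2 := (Complex.abs_im_le_norm _).trans this
  simp at h1 h2
  refine ⟨?_, by simpa [← sub_sub] using h2⟩
  have hp := h.pos _ hs
  have e3 : (F ζ).re - X ζ.re = ((F ζ).re - X ζ.re + v ζ.re * ζ.im) - v ζ.re * ζ.im := by ring
  rw [e3]
  refine (abs_sub _ _).trans ?_
  rw [abs_mul, abs_of_pos hp]
  linarith

theorem X_pos (h : IsSlowSpiral V F v X Y) {s : ℝ} (hs : -1 < s) : 0 < X s := by
  linarith [h.v_le_X hs, h.pos s hs]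

theorem half_X_le_re (h : IsSlowSpiral V F v X Y) {ζ : ℂ} (hs : -1 < ζ.re)
    (hi : |ζ.im| < Real.pi / 2) : X ζ.re / 2 ≤ (F ζ).re := by
  have hpi := Real.pi_lt_d2
  have h1 := (abs_le.1 (h.abs_coord_le hs (by linarith)).1).1
  have h2 := h.v_le_X hs
  have h3 := h.pos _ hs
  have h4 : v ζ.re * |ζ.im| ≤ v ζ.re * 1.6 := by gcongr; linarith
  linarith

theorem injOn (h : IsSlowSpiral V F v X Y) :
    InjOn F {ζ : ℂ | -1 < ζ.re ∧ |ζ.im| < Real.pi / 2} := by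
  intro ξ hξ ζ hζ hF
  by_contra hne
  have hpi := Real.pi_lt_d2
  have hsub : ζ - ξ ≠ 0 := sub_ne_zero.2 (Ne.symm hne)
  have hseg : ∀ t ∈ Icc (0 : ℝ) 1, -1 < (ξ + t * (ζ - ξ)).re ∧ |(ξ + t * (ζ - ξ)).im| ≤ 2 := by
    intro t ht
    have e1 : (ξ + t * (ζ - ξ)).re = (1 - t) * ξ.re + t * ζ.re := by simp; ring
    have e2 : (ξ + t * (ζ - ξ)).im = (1 - t) * ξ.im + t * ζ.im := by simp; ring
    have h1 : 0 ≤ 1 - t := by linarith [ht.2]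
    have h0 := ht.1
    obtain ⟨a1, a2⟩ := abs_lt.1 hξ.2
    obtain ⟨b1, b2⟩ := abs_lt.1 hζ.2
    rw [e1, e2]
    refine ⟨?_, abs_le.2 ⟨?_, ?_⟩⟩
    · rcases h0.eq_or_lt with h0 | h0
      · subst h0; simpa using hξ.1
      · nlinarith [hξ.1, hζ.1]
    · nlinarith
    · nlinarith
  let g : ℝ → ℝ := fun t => (-I * F (ξ + t * (ζ - ξ)) / (ζ - ξ)).re
  have hderiv : ∀ t ∈ Icc (0 : ℝ) 1, HasDerivAt g
      (-I * (I * V (ξ + t * (ζ - ξ)) - (3 / 8) * V (ξ + t * (ζ - ξ)) ^ 2)).re t := by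
    intro t ht
    have hc : HasDerivAt (fun w : ℂ => ξ + w * (ζ - ξ)) (ζ - ξ) (t : ℂ) := by
      simpa using ((hasDerivAt_id (t : ℂ)).mul_const (ζ - ξ)).const_add ξ
    have hF' := (h.hasDerivAt (ξ + t * (ζ - ξ)) (by linarith [(hseg t ht).1])).comp (t : ℂ) hc
    have := ((hF'.const_mul (-I)).div_const (ζ - ξ)).real_of_complex
    refine this.congr_deriv ?_
    rw [← mul_assoc, mul_div_cancel_right₀ _ hsub]
  have hpos : ∀ t ∈ Icc (0 : ℝ) 1,
      0 < (-I * (I * V (ξ + t * (ζ - ξ)) - (3 / 8) * V (ξ + t * (ζ - ξ)) ^ 2)).re := by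
    intro t ht
    obtain ⟨h1, h2⟩ := hseg t ht
    set w := ξ + t * (ζ - ξ)
    have e : w - (w.re : ℂ) = w.im * I := by apply Complex.ext <;> simp
    have hn := h.norm_deriv_sub_le h1 (ζ := w) (by rw [e]; simpa using h2)
    have hp := h.pos _ h1
    have e2 : -I * (I * V w - (3 / 8) * V w ^ 2)
        = v w.re + -I * (I * V w - (3 / 8) * V w ^ 2 - I * v w.re) := by
      linear_combination (-(v w.re : ℂ)) * I_mul_I
    rw [e2, add_re, ofReal_re]
    have h3 := (abs_le.1 (Complex.abs_re_le_norm
      (-I * (I * V w - (3 / 8) * V w ^ 2 - I * v w.re)))).1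
    rw [norm_mul, norm_neg, norm_I, one_mul] at h3
    linarith
  have hmono : StrictMonoOn g (Icc 0 1) := by
    refine strictMonoOn_of_hasDerivWithinAt_pos (convex_Icc 0 1)
      (fun t ht => (hderiv t ht).continuousAt.continuousWithinAt)
      (fun t ht => (hderiv t (interior_subset ht)).hasDerivWithinAt)
      (fun t ht => hpos t (interior_subset ht))
  have := hmono (left_mem_Icc.2 zero_le_one) (right_mem_Icc.2 zero_le_one) zero_lt_one
  simp [g, hF] at this

/-- Two points of the image with the same real part differ in height by less than two turns. -/
theorem im_sub_lt (h : IsSlowSpiral V F v X Y) {ξ ζ : ℂ} (hξ : -1 < ξ.re) (hξ' : |ξ.im| < Real.pi / 2)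
    (hζ : -1 < ζ.re) (hζ' : |ζ.im| < Real.pi / 2) (hre : (F ξ).re = (F ζ).re) :
    (F ξ).im - (F ζ).im < 4 * Real.pi := by
  by_contra! hcon
  have hpi := Real.pi_lt_d2
  have hpi' := Real.pi_gt_d2
  obtain ⟨a1, a2⟩ := h.abs_coord_le hξ (by linarith)
  obtain ⟨b1, b2⟩ := h.abs_coord_le hζ (by linarith)
  have pξ := h.pos _ hξ
  have pζ := h.pos _ hζ
  have lξ := h.le_small _ hξ
  have lζ := h.le_small _ hζ
  have c1 : v ξ.re * |ξ.im| ≤ v ξ.re * 1.575 := by gcongr; linarith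
  have c2 : v ζ.re * |ζ.im| ≤ v ζ.re * 1.575 := by gcongr; linarith
  rw [abs_le] at a1 a2 b1 b2
  have hY : 12.5 ≤ Y ξ.re - Y ζ.re := by linarith [a2.2, b2.1]
  have hlt : ζ.re ≤ ξ.re := by
    by_contra! hlt
    linarith [h.Y_mono hξ hlt.le]
  have d1 := h.le_X_sub hζ hlt
  have d2 := h.v_sub_le hζ hlt
  have d3 : 3 / 8 * v ξ.re * 12.5 ≤ 3 / 8 * v ξ.re * (Y ξ.re - Y ζ.re) := by gcongr
  linarith [a1.1, b1.2]

theorem surjOn_ball (h : IsSlowSpiral V F v X Y) {s : ℝ} (hs : -1 < s) :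
    SurjOn F (Metric.closedBall (s : ℂ) (3 / 2)) (Metric.closedBall (F s) (147 / 100 * v s)) := by
  have hp := h.pos s hs
  have hne : I * (v s : ℂ) ≠ 0 := mul_ne_zero I_ne_zero (by exact_mod_cast hp.ne')
  let L : ℂ →L[ℂ] ℂ := (I * (v s : ℂ)) • ContinuousLinearMap.id ℂ ℂ
  let R : L.NonlinearRightInverse :=
    { toFun := fun y => y / (I * v s)
      nnnorm := (v s)⁻¹.toNNReal
      bound' := fun y => by
        rw [Real.coe_toNNReal _ (by positivity), norm_div, norm_mul, norm_I, one_mul,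
          Complex.norm_real, Real.norm_of_nonneg hp.le, div_eq_inv_mul]
      right_inv' := fun y => by
        change I * (v s : ℂ) * (y / (I * v s)) = y
        rw [mul_comm, div_mul_cancel₀ _ hne] }
  have hA : ApproximatesLinearOn F L (Metric.closedBall (s : ℂ) (3 / 2)) (v s / 50).toNNReal := by
    intro ζ hζ ξ hξ
    rw [mem_closedBall_iff_norm] at hζ hξ
    rw [Real.coe_toNNReal _ (by positivity)]
    exact h.norm_sub_sub_le hs (ζ := ζ) (ξ := ξ) (by linarith) (by linarith)
  refine (hA.surjOn_closedBall_of_nonlinearRightInverse R (ε := 3 / 2) (b := s) (by norm_num)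
    subset_rfl).mono subset_rfl (Metric.closedBall_subset_closedBall ?_)
  simp only [R]
  rw [Real.coe_toNNReal _ (by positivity), Real.coe_toNNReal _ (by positivity), inv_inv]
  linarith

/-- The image of any far right part of a strip of half-width `3/2` winds around every level close
to the imaginary axis. -/
theorem exists_radius (h : IsSlowSpiral V F v X Y) {M : ℝ} (hM : -1 < M) :
    ∃ x₀ > 0, ∀ x y : ℝ, 0 < x → x < x₀ → |y| ≤ Real.pi → ∃ ζ : ℂ, ∃ k : ℕ,
      M - 2 ≤ ζ.re ∧ |ζ.im| ≤ 3 / 2 ∧ F ζ = x + (y + 2 * Real.pi * k) * I := by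
  have hpi := Real.pi_pos
  have hcont : ContinuousOn Y (Ici M) := fun s hs =>
    (h.hasDerivAt_Y s (hM.trans_le hs)).continuousAt.continuousWithinAt
  have hsurj : ∀ p, Y M ≤ p → ∃ s, M ≤ s ∧ Y s = p := by
    intro p hp
    obtain ⟨T, hT, hMT⟩ := ((h.tendsto_Y.eventually_ge_atTop p).and
      (eventually_ge_atTop M)).exists
    obtain ⟨s, hs, rfl⟩ := intermediate_value_Icc hMT (hcont.mono Icc_subset_Ici_self) ⟨hp, hT⟩
    exact ⟨s, hs.1, rfl⟩
  obtain ⟨k₀, hk₀⟩ := exists_nat_gt ((Y M + Real.pi) / (2 * Real.pi))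
  rw [div_lt_iff₀ (by positivity)] at hk₀
  obtain ⟨S, hS, hYS⟩ := hsurj (Real.pi + 2 * Real.pi * k₀) (by nlinarith)
  refine ⟨X S, h.X_pos (hM.trans_le hS), fun x y hx hxS hy => ?_⟩
  obtain ⟨y1, y2⟩ := abs_le.1 hy
  have hk : ∀ n : ℕ, ∃ s, M ≤ s ∧ Y s = y + 2 * Real.pi * ((k₀ + n : ℕ) : ℝ) := by
    intro n
    refine hsurj _ ?_
    have : (0 : ℝ) ≤ 2 * Real.pi * n := by positivity
    push_cast
    linarith
  choose s hsM hsY using hk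
  have hs1 : ∀ n, -1 < s n := fun n => hM.trans_le (hsM n)
  have hex : ∃ n, X (s n) ≤ x := by
    obtain ⟨T, hT, hMT⟩ := ((h.tendsto_X.eventually_lt_const hx).and
      (eventually_ge_atTop M)).exists
    obtain ⟨n, hn⟩ := exists_nat_gt ((Y T - y) / (2 * Real.pi))
    rw [div_lt_iff₀ (by positivity)] at hn
    refine ⟨n, ?_⟩
    by_contra! hlt
    have hle : s n ≤ T := by
      by_contra! hc
      linarith [h.X_anti (hM.trans_le hMT) hc.le]
    have := h.Y_mono (hs1 n) hle
    rw [hsY n] at this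
    have : (0 : ℝ) ≤ 2 * Real.pi * k₀ := by positivity
    push_cast at *
    linarith
  classical
  have hfin : ∃ n, |X (s n) - x| ≤ 147 / 100 * v (s n) := by
    rcases hn : Nat.find hex with _ | n
    · exfalso
      have h0 : X (s 0) ≤ x := by simpa [hn] using Nat.find_spec hex
      have hle : s 0 ≤ S ∨ S < s 0 := le_or_gt _ _
      rcases hle with hle | hlt
      · linarith [h.X_anti (hs1 0) hle]
      · have hYY := h.Y_mono (hM.trans_le hS) hlt.le
        rw [hsY 0, hYS] at hYY
        have hyy : Y S = Y (s 0) := by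
          rw [hsY 0, hYS]
          push_cast at *
          linarith
        have := h.X_sub_le (hM.trans_le hS) hlt.le
        rw [hyy] at this
        linarith
    · have hle : X (s (n + 1)) ≤ x := by simpa [hn] using Nat.find_spec hex
      have hlt : x < X (s n) := not_le.1 (Nat.find_min hex (by omega))
      have hss : s n ≤ s (n + 1) := by
        by_contra! hc
        linarith [h.X_anti (hs1 (n + 1)) hc.le]
      have e : Y (s (n + 1)) - Y (s n) = 2 * Real.pi := by
        rw [hsY, hsY]; push_cast; ring
      have g1 := h.X_sub_le (hs1 n) hss
      rw [e] at g1
      have g2 := h.v_sub_le (hs1 n) hss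
      have g3 := h.pos _ (hs1 n)
      have g4 : 3 / 8 * v (s n) * (2 * Real.pi) ≤ 3 / 8 * v (s n) * (2 * 3.15) := by
        gcongr
        exact Real.pi_lt_d2.le
      rcases le_total x ((X (s n) + X (s (n + 1))) / 2) with hc | hc
      · refine ⟨n + 1, abs_le.2 ⟨?_, ?_⟩⟩ <;> linarith [h.pos _ (hs1 (n + 1))]
      · refine ⟨n, abs_le.2 ⟨?_, ?_⟩⟩ <;> linarith [h.pos _ (hs1 (n + 1))]
  obtain ⟨n, hn⟩ := hfin
  obtain ⟨ζ, hζ, hFζ⟩ := h.surjOn_ball (hs1 n)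
    (show (x + (y + 2 * Real.pi * ((k₀ + n : ℕ) : ℝ)) * I : ℂ) ∈ _ by
      rw [mem_closedBall_iff_norm, h.eq_real, hsY]
      have : (x + (y + 2 * Real.pi * ((k₀ + n : ℕ) : ℝ)) * I : ℂ)
          - (X (s n) + (y + 2 * Real.pi * ((k₀ + n : ℕ) : ℝ) : ℝ) * I)
          = ((x - X (s n) : ℝ) : ℂ) := by
        push_cast; ring
      rw [this, Complex.norm_real, Real.norm_eq_abs, abs_sub_comm]
      exact hn)
  rw [mem_closedBall_iff_norm] at hζ
  refine ⟨ζ, k₀ + n, ?_, ?_, hFζ⟩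
  · have := (abs_le.1 ((Complex.abs_re_le_norm _).trans hζ)).1
    simp at this
    linarith [hsM n]
  · simpa using (Complex.abs_im_le_norm _).trans hζ

end IsSlowSpiral

theorem mem_unitDisk {z : ℂ} : z ∈ unitDisk ↔ ‖z‖ < 1 := mem_ball_zero_iff

theorem one_sub_re_pos {z : ℂ} (hz : z ∈ unitDisk) : 0 < (1 - z).re := by
  rw [mem_unitDisk] at hz
  have := (Complex.re_le_norm z).trans_lt hz
  simp
  linarith

/-- The logarithmic coordinate `-log (1 - z)` sends the disk into a half-strip. -/
theorem neg_log_one_sub_mem {z : ℂ} (hz : z ∈ unitDisk) :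
    -1 < (-log (1 - z)).re ∧ |(-log (1 - z)).im| < Real.pi / 2 := by
  have h1 := one_sub_re_pos hz
  have hne : 1 - z ≠ 0 := fun h => by simp [h] at h1
  constructor
  · rw [neg_re, log_re]
    have h2 : ‖1 - z‖ < 2 := by
      rw [mem_unitDisk] at hz
      refine (norm_sub_le _ _).trans_lt ?_
      rw [norm_one]
      linarith
    have := Real.log_lt_log (norm_pos_iff.2 hne) h2
    linarith [Real.log_two_lt_d9]
  · rw [neg_im, log_im, abs_neg]
    exact abs_arg_lt_pi_div_two_iff.2 (Or.inl h1)

theorem injOn_neg_log_one_sub : InjOn (fun z : ℂ => -log (1 - z)) unitDisk := by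
  intro z hz w hw h
  have h1 := one_sub_re_pos hz
  have h2 := one_sub_re_pos hw
  have e := congrArg Complex.exp (neg_injective h)
  rw [exp_log (fun h => by simp [h] at h1), exp_log (fun h => by simp [h] at h2)] at e
  linear_combination -e

theorem exists_neg_log_one_sub_eq :
    ∃ M : ℝ, 0 ≤ M ∧ ∀ ζ : ℂ, M ≤ ζ.re → |ζ.im| ≤ 3 / 2 → ∃ z ∈ unitDisk, -log (1 - z) = ζ := by
  have hpi := Real.pi_gt_d2
  have hc : 0 < Real.cos (3 / 2) :=
    Real.cos_pos_of_mem_Ioo ⟨by linarith, by linarith⟩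
  obtain ⟨M, hM⟩ := (((Real.tendsto_exp_atTop.const_mul_atTop hc).eventually_gt_atTop (1 / 2)).and
    (eventually_ge_atTop 0)).exists
  refine ⟨M, hM.2, fun ζ hr hi => ⟨1 - Complex.exp (-ζ), ?_, ?_⟩⟩
  · have hcos : Real.cos (3 / 2) ≤ Real.cos ζ.im := by
      rw [← Real.cos_abs ζ.im]
      exact Real.cos_le_cos_of_nonneg_of_le_pi (abs_nonneg _) (by linarith) hi
    have hre : 1 / 2 < (Complex.exp ζ).re := by
      rw [Complex.exp_re]
      refine hM.1.trans_le ?_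
      rw [mul_comm]
      gcongr
    have e : 1 - Complex.exp (-ζ) = (Complex.exp ζ - 1) / Complex.exp ζ := by
      rw [Complex.exp_neg]
      field_simp [Complex.exp_ne_zero]
    rw [mem_unitDisk, e, norm_div, div_lt_one (norm_pos_iff.2 (Complex.exp_ne_zero _))]
    refine lt_of_pow_lt_pow_left₀ 2 (norm_nonneg _) ?_
    rw [← normSq_eq_norm_sq, ← normSq_eq_norm_sq, normSq_sub]
    simp
    linarith
  · obtain ⟨h1, h2⟩ := abs_le.1 hi
    rw [sub_sub_cancel, log_exp (by simp; linarith) (by simp; linarith), neg_neg]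

theorem encard_le_two_of_forall {S : Set ℂ}
    (hS : ∀ x ∈ S, ∀ y ∈ S, ∀ z ∈ S, x = y ∨ x = z ∨ y = z) : S.encard ≤ 2 := by
  have hpair : ∀ x y : ℂ, ({x, y} : Set ℂ).encard ≤ 2 := fun x y =>
    (Set.encard_insert_le _ _).trans (by rw [Set.encard_singleton]; norm_num)
  rcases S.eq_empty_or_nonempty with rfl | ⟨x, hx⟩
  · simp
  by_cases h : ∃ y ∈ S, x ≠ y
  · obtain ⟨y, hy, hxy⟩ := h
    refine (Set.encard_le_encard (t := {x, y}) fun z hz => ?_).trans (hpair x y)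
    rcases hS x hx y hy z hz with h | h | h
    · exact absurd h hxy
    · simp [h]
    · simp [h]
  · push Not at h
    refine (Set.encard_le_encard (t := {x, x}) fun z hz => ?_).trans (hpair x x)
    simp [h z hz]

/-- The degree two Blaschke product with zeros `0` and `a`, up to sign. -/
def blaschkeTwo (a : ℝ) (w : ℂ) : ℂ := w * ((a - w) / (1 - a * w))

section Blaschke

variable {a : ℝ} {w : ℂ}

theorem one_sub_mul_ne_zero (ha : 0 < a) (ha1 : a < 1) (hw : ‖w‖ < 1) : 1 - a * w ≠ 0 := by
  intro h
  have h1 : ‖(a : ℂ) * w‖ = 1 := by rw [← sub_eq_zero.1 h, norm_one]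
  rw [norm_mul, Complex.norm_real, Real.norm_of_nonneg ha.le] at h1
  nlinarith [norm_nonneg w]

theorem one_sub_norm_sq_moebius (ha : 0 < a) (ha1 : a < 1) (hw : ‖w‖ < 1) :
    1 - ‖(a - w) / (1 - a * w)‖ ^ 2 = (1 - a ^ 2) * (1 - ‖w‖ ^ 2) / ‖1 - a * w‖ ^ 2 := by
  have h := one_sub_mul_ne_zero ha ha1 hw
  have h' : ‖1 - a * w‖ ^ 2 ≠ 0 := pow_ne_zero _ (norm_ne_zero_iff.2 h)
  rw [norm_div, div_pow, eq_div_iff h', sub_mul, div_mul_cancel₀ _ h']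
  simp only [← normSq_eq_norm_sq, normSq_apply]
  simp
  ring

theorem norm_moebius_lt_one (ha : 0 < a) (ha1 : a < 1) (hw : ‖w‖ < 1) :
    ‖(a - w) / (1 - a * w)‖ < 1 := by
  have h := one_sub_norm_sq_moebius ha ha1 hw
  have h' := norm_pos_iff.2 (one_sub_mul_ne_zero ha ha1 hw)
  have : 0 < (1 - a ^ 2) * (1 - ‖w‖ ^ 2) / ‖1 - a * w‖ ^ 2 := by
    have h1 : 0 < 1 - a ^ 2 := by nlinarith
    have h2 : 0 < 1 - ‖w‖ ^ 2 := by nlinarith [norm_nonneg w]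
    positivity
  nlinarith [norm_nonneg ((a - w) / (1 - a * w))]

theorem norm_blaschkeTwo_le (ha : 0 < a) (ha1 : a < 1) (hw : ‖w‖ < 1) :
    ‖blaschkeTwo a w‖ ≤ ‖w‖ := by
  rw [blaschkeTwo, norm_mul]
  exact mul_le_of_le_one_right (norm_nonneg _) (norm_moebius_lt_one ha ha1 hw).le

theorem eq_or_eq_of_blaschkeTwo_eq {w' : ℂ} (ha : 0 < a) (ha1 : a < 1) (hw : ‖w‖ < 1)
    (hw' : ‖w'‖ < 1) (h : blaschkeTwo a w = blaschkeTwo a w') :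
    w = w' ∨ w = (a - w') / (1 - a * w') := by
  have h1 := one_sub_mul_ne_zero ha ha1 hw
  have h2 := one_sub_mul_ne_zero ha ha1 hw'
  rw [blaschkeTwo, blaschkeTwo, ← mul_div_assoc, ← mul_div_assoc, div_eq_div_iff h1 h2] at h
  have h3 : (w - w') * (a - w - w' + a * w * w') = 0 := by linear_combination h
  rcases mul_eq_zero.1 h3 with h3 | h3
  · exact Or.inl (sub_eq_zero.1 h3)
  · right
    rw [eq_div_iff h2]
    linear_combination -h3

theorem exists_blaschkeTwo_eq (ha : 0 < a) (ha1 : a < 1) {u : ℂ} (hu : ‖u‖ < 1) :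
    ∃ w : ℂ, ‖w‖ < 1 ∧ blaschkeTwo a w = u := by
  obtain ⟨d, hd⟩ := IsAlgClosed.exists_pow_nat_eq ((a * (1 + u)) ^ 2 - 4 * u) (n := 2) two_pos
  have key : ∀ w : ℂ, ‖w‖ < 1 → w ^ 2 - a * (1 + u) * w + u = 0 → blaschkeTwo a w = u := by
    intro w hw h
    rw [blaschkeTwo, ← mul_div_assoc, div_eq_iff (one_sub_mul_ne_zero ha ha1 hw)]
    linear_combination -h
  have hprod : (a * (1 + u) + d) / 2 * ((a * (1 + u) - d) / 2) = u := by
    linear_combination -hd / 4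
  rcases lt_or_ge ‖(a * (1 + u) + d) / 2‖ 1 with h | h
  · exact ⟨_, h, key _ h (by linear_combination hd / 4)⟩
  · have h2 : ‖(a * (1 + u) - d) / 2‖ < 1 := by
      by_contra! hc
      have := congrArg norm hprod
      rw [norm_mul] at this
      nlinarith
    exact ⟨_, h2, key _ h2 (by linear_combination hd / 4)⟩

theorem blaschkeTwo_moebius (ha : 0 < a) (ha1 : a < 1) (hw : ‖w‖ < 1) :
    blaschkeTwo a ((a - w) / (1 - a * w)) = blaschkeTwo a w := by
  have h1 := one_sub_mul_ne_zero ha ha1 hw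
  have h2 := one_sub_mul_ne_zero ha ha1 (norm_moebius_lt_one ha ha1 hw)
  have e : (a - (a - w) / (1 - a * w)) / (1 - a * ((a - w) / (1 - a * w))) = w := by
    rw [div_eq_iff h2]
    field_simp
    ring
  rw [blaschkeTwo, e, blaschkeTwo, mul_comm]

theorem exists_blaschkeTwo_surj {r : ℝ} (hr : 0 < r) (hr1 : r < 1) :
    ∃ a : ℝ, 0 < a ∧ a < 1 ∧ ∀ u : ℂ, ‖u‖ < 1 → ∃ w : ℂ, r < ‖w‖ ∧ ‖w‖ < 1 ∧
      blaschkeTwo a w = u := by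
  have hq : 0 < (1 - r ^ 2) * (1 - r) ^ 2 := by
    have h1 : 0 < 1 - r ^ 2 := by nlinarith
    have h2 : 0 < 1 - r := by linarith
    positivity
  have hq1 : (1 - r ^ 2) * (1 - r) ^ 2 < 1 := by
    have h1 : 1 - r ^ 2 < 1 := by nlinarith
    have h2 : (1 - r) ^ 2 < 1 := by nlinarith
    nlinarith [sq_nonneg (1 - r)]
  set q := (1 - r ^ 2) * (1 - r) ^ 2 with hqdef
  have ha : 0 < 1 - q / 2 := by linarith
  have ha1 : 1 - q / 2 < 1 := by linarith
  refine ⟨1 - q / 2, ha, ha1, fun u hu => ?_⟩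
  obtain ⟨w, hw, hwu⟩ := exists_blaschkeTwo_eq ha ha1 hu
  rcases lt_or_ge r ‖w‖ with h | h
  · exact ⟨w, h, hw, hwu⟩
  refine ⟨_, ?_, norm_moebius_lt_one ha ha1 hw, (blaschkeTwo_moebius ha ha1 hw).trans hwu⟩
  have hid := one_sub_norm_sq_moebius ha ha1 hw
  set a := 1 - q / 2 with hadef
  have hden : 1 - r ≤ ‖1 - a * w‖ := by
    have h1 := norm_sub_norm_le (1 : ℂ) (a * w)
    rw [norm_one, norm_mul, Complex.norm_real, Real.norm_of_nonneg ha.le] at h1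
    nlinarith [norm_nonneg w]
  have hlt : (1 - a ^ 2) * (1 - ‖w‖ ^ 2) / ‖1 - a * w‖ ^ 2 < 1 - r ^ 2 := by
    rw [div_lt_iff₀ (by have : 0 < ‖1 - a * w‖ := by linarith
                        positivity)]
    have h2 : (1 - r) ^ 2 ≤ ‖1 - a * w‖ ^ 2 := by
      have : 0 ≤ 1 - r := by linarith
      gcongr
    have h3 : 1 - a ^ 2 < q := by rw [hadef]; nlinarith
    have h4 : 0 < 1 - r ^ 2 := by nlinarith
    have h5 : 0 < 1 - a ^ 2 := by nlinarith
    calc (1 - a ^ 2) * (1 - ‖w‖ ^ 2) ≤ 1 - a ^ 2 :=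
          mul_le_of_le_one_right h5.le (by nlinarith [sq_nonneg ‖w‖])
      _ < q := h3
      _ ≤ (1 - r ^ 2) * ‖1 - a * w‖ ^ 2 := by rw [hqdef]; gcongr
  refine lt_of_pow_lt_pow_left₀ 2 (norm_nonneg _) ?_
  linarith

end Blaschke

namespace IsSlowSpiral

variable {V F : ℂ → ℂ} {v X Y : ℝ → ℝ}

theorem exp_comp_norm_le (h : IsSlowSpiral V F v X Y) {z : ℂ} (hz : z ∈ unitDisk) :
    ‖Complex.exp (-F (-log (1 - z)))‖ ≤ Real.exp (-(X (-Real.log ‖1 - z‖) / 2)) := by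
  obtain ⟨h1, h2⟩ := neg_log_one_sub_mem hz
  have := h.half_X_le_re h1 h2
  rw [neg_re, log_re] at this
  rw [Complex.norm_exp, neg_re]
  gcongr

theorem exp_comp_norm_lt_one (h : IsSlowSpiral V F v X Y) {z : ℂ} (hz : z ∈ unitDisk) :
    ‖Complex.exp (-F (-log (1 - z)))‖ < 1 := by
  refine (h.exp_comp_norm_le hz).trans_lt ?_
  rw [Real.exp_lt_one_iff, neg_lt_zero]
  have h1 := (neg_log_one_sub_mem hz).1
  rw [neg_re, log_re] at h1
  exact half_pos (h.X_pos h1)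

theorem exp_comp_differentiableOn (h : IsSlowSpiral V F v X Y) :
    DifferentiableOn ℂ (fun z => Complex.exp (-F (-log (1 - z)))) unitDisk := by
  intro z hz
  have h1 := (neg_log_one_sub_mem hz).1
  have h2 : DifferentiableAt ℂ (fun z : ℂ => -log (1 - z)) z :=
    (((differentiableAt_const _).sub differentiableAt_id).clog
      (Or.inl (one_sub_re_pos hz))).neg
  have h3 : DifferentiableAt ℂ F (-log (1 - z)) :=
    (h.hasDerivAt _ (by linarith)).differentiableAt
  exact ((h3.comp z h2).neg.cexp).differentiableWithinAt

theorem exp_comp_encard_le (h : IsSlowSpiral V F v X Y) (w : ℂ) :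
    {z ∈ unitDisk | Complex.exp (-F (-log (1 - z))) = w}.encard ≤ 2 := by
  have key : ∀ x ∈ unitDisk, ∀ y ∈ unitDisk,
      Complex.exp (-F (-log (1 - x))) = Complex.exp (-F (-log (1 - y))) →
      ∃ n : ℤ, (F (-log (1 - x))).im - (F (-log (1 - y))).im = 2 * Real.pi * n ∧
        -2 < n ∧ n < 2 ∧ (n = 0 → x = y) := by
    intro x hx y hy hxy
    obtain ⟨n, hn⟩ := Complex.exp_eq_exp_iff_exists_int.1 hxy
    obtain ⟨hx1, hx2⟩ := neg_log_one_sub_mem hx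
    obtain ⟨hy1, hy2⟩ := neg_log_one_sub_mem hy
    have hre := congrArg re hn
    have him := congrArg im hn
    simp at hre him
    have hpi := Real.pi_pos
    have l1 := h.im_sub_lt hx1 hx2 hy1 hy2 hre
    have l2 := h.im_sub_lt hy1 hy2 hx1 hx2 hre.symm
    refine ⟨-n, ?_, ?_, ?_, ?_⟩
    · push_cast; linarith
    · have : (n : ℝ) < 2 := by
        by_contra! hc
        nlinarith
      have : n < 2 := by exact_mod_cast this
      omega
    · have : (-2 : ℝ) < n := by
        by_contra! hc
        nlinarith
      have : -2 < n := by exact_mod_cast this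
      omega
    · intro hn0
      have hn0 : n = 0 := by omega
      subst hn0
      exact injOn_neg_log_one_sub hx hy
        (h.injOn ⟨hx1, hx2⟩ ⟨hy1, hy2⟩ (by simpa using hn))
  refine encard_le_two_of_forall ?_
  rintro x ⟨hx, hxw⟩ y ⟨hy, hyw⟩ z ⟨hz, hzw⟩
  obtain ⟨k, k1, k2, k3, k4⟩ := key x hx y hy (hxw.trans hyw.symm)
  obtain ⟨l, l1, l2, l3, l4⟩ := key y hy z hz (hyw.trans hzw.symm)
  obtain ⟨m, m1, m2, m3, m4⟩ := key x hx z hz (hxw.trans hzw.symm)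
  have hsum : m = k + l := by
    have : 2 * Real.pi * (m : ℝ) = 2 * Real.pi * ((k + l : ℤ) : ℝ) := by
      push_cast
      linarith
    exact_mod_cast mul_left_cancel₀ (by positivity) this
  by_cases hk : k = 0
  · exact Or.inl (k4 hk)
  by_cases hm : m = 0
  · exact Or.inr (Or.inl (m4 hm))
  exact Or.inr (Or.inr (l4 (by omega)))

theorem exp_comp_surj (h : IsSlowSpiral V F v X Y) :
    ∃ r : ℝ, 0 < r ∧ r < 1 ∧ ∀ w : ℂ, r < ‖w‖ → ‖w‖ < 1 →
      ∃ z ∈ unitDisk, Complex.exp (-F (-log (1 - z))) = w := by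
  obtain ⟨M, hM, hlog⟩ := exists_neg_log_one_sub_eq
  obtain ⟨x₀, hx₀, hF⟩ := h.exists_radius (M := M + 2) (by linarith)
  refine ⟨Real.exp (-x₀), Real.exp_pos _, by simpa using hx₀, fun w hw hw1 => ?_⟩
  have hw0 : 0 < ‖w‖ := (Real.exp_pos _).trans hw
  have hx : 0 < -Real.log ‖w‖ := neg_pos.2 (Real.log_neg hw0 hw1)
  have hx' : -Real.log ‖w‖ < x₀ := by
    have := Real.log_lt_log (Real.exp_pos _) hw
    rw [Real.log_exp] at this
    linarith
  obtain ⟨ζ, k, hζ, hζ', hFζ⟩ := hF _ (-arg w) hx hx' (by rw [abs_neg]; exact abs_arg_le_pi w)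
  obtain ⟨z, hz, rfl⟩ := hlog ζ (by linarith) hζ'
  refine ⟨z, hz, ?_⟩
  rw [hFζ]
  have e : -(((-Real.log ‖w‖ : ℝ) : ℂ) + (((-arg w : ℝ) : ℂ) + 2 * Real.pi * k) * I)
      = log w - (k : ℤ) * (2 * Real.pi * I) := by
    rw [log]
    push_cast
    ring
  rw [e, Complex.exp_sub, Complex.exp_int_mul_two_pi_mul_I, div_one,
    exp_log (norm_pos_iff.1 hw0)]

theorem exists_symbol (h : IsSlowSpiral V F v X Y) :
    ∃ ψ : ℂ → ℂ, IsSymbol ψ ∧ ψ '' unitDisk = unitDisk ∧ Valent ψ 4 ∧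
      ∀ z ∈ unitDisk, ‖ψ z‖ ≤ Real.exp (-(X (-Real.log ‖1 - z‖) / 2)) := by
  obtain ⟨r, hr, hr1, hsurj⟩ := h.exp_comp_surj
  obtain ⟨a, ha, ha1, hB⟩ := exists_blaschkeTwo_surj hr hr1
  set E : ℂ → ℂ := fun z => Complex.exp (-F (-log (1 - z))) with hE
  have hE1 : ∀ z ∈ unitDisk, ‖E z‖ < 1 := fun z hz => h.exp_comp_norm_lt_one hz
  have hmaps : MapsTo (fun z => blaschkeTwo a (E z)) unitDisk unitDisk := fun z hz =>
    mem_unitDisk.2 ((norm_blaschkeTwo_le ha ha1 (hE1 z hz)).trans_lt (hE1 z hz))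
  have himage : (fun z => blaschkeTwo a (E z)) '' unitDisk = unitDisk := by
    refine subset_antisymm hmaps.image_subset fun u hu => ?_
    obtain ⟨w, hw, hw1, rfl⟩ := hB u (mem_unitDisk.1 hu)
    obtain ⟨z, hz, rfl⟩ := hsurj w hw hw1
    exact ⟨z, hz, rfl⟩
  refine ⟨fun z => blaschkeTwo a (E z), ⟨hmaps, ?_, ?_⟩, himage, ?_, fun z hz => ?_⟩
  · have hd : DifferentiableOn ℂ E unitDisk := h.exp_comp_differentiableOn
    exact hd.mul ((hd.const_sub _).div ((hd.const_mul _).const_sub _)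
      fun z hz => one_sub_mul_ne_zero ha ha1 (hE1 z hz))
  · rintro ⟨c, hc⟩
    have hall : ∀ u ∈ unitDisk, u = c := by
      intro u hu
      rw [← himage] at hu
      obtain ⟨z, hz, rfl⟩ := hu
      exact hc hz
    have h0 := hall 0 (mem_unitDisk.2 (by simp))
    have h1 := hall (1 / 2) (mem_unitDisk.2 (by norm_num))
    rw [← h0] at h1
    norm_num at h1
  · intro u hu
    rw [← himage] at hu
    obtain ⟨z, hz, rfl⟩ := hu
    refine (Set.encard_le_encard (t := {x ∈ unitDisk | E x = E z} ∪
      {x ∈ unitDisk | E x = (a - E z) / (1 - a * E z)}) ?_).trans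
      ((Set.encard_union_le _ _).trans
        ((add_le_add (h.exp_comp_encard_le _) (h.exp_comp_encard_le _)).trans (by norm_num)))
    rintro x ⟨hx, hxz⟩
    rcases eq_or_eq_of_blaschkeTwo_eq ha ha1 (hE1 x hx) (hE1 z hz) hxz with e | e
    · exact Or.inl ⟨hx, e⟩
    · exact Or.inr ⟨hx, e⟩
  · exact (norm_blaschkeTwo_le ha ha1 (hE1 z hz)).trans (h.exp_comp_norm_le hz)

end IsSlowSpiral

section Construction

/-- The weights `2^{-(n+1)}`, summing to `1`. -/
def weight (n : ℕ) : ℝ := 1 / 2 * (1 / 2) ^ n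

theorem weight_pos (n : ℕ) : 0 < weight n := by unfold weight; positivity

theorem hasSum_weight : HasSum weight 1 := by
  have := hasSum_geometric_two.mul_left (1 / 2 : ℝ)
  norm_num at this
  exact this

theorem weight_le_half (n : ℕ) : weight n ≤ 1 / 2 := by
  unfold weight
  have : (1 / 2 : ℝ) ^ n ≤ 1 := pow_le_one₀ (by norm_num) (by norm_num)
  linarith

variable {b : ℕ → ℝ}

theorem le_of_hundred_le (hb : ∀ n, 100 ≤ weight n * b n) (n : ℕ) : 200 ≤ b n := by
  have h1 := hb n
  have h2 := weight_le_half n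
  have h3 := weight_pos n
  have : 0 ≤ b n := by
    by_contra! hc
    nlinarith
  nlinarith

/-- The real speed `∑ βₙ bₙ / (s + bₙ²)`. -/
def speed (b : ℕ → ℝ) (s : ℝ) : ℝ := ∑' n, weight n * b n / (s + b n ^ 2)

/-- The complex extension of `speed`. -/
def cspeed (b : ℕ → ℝ) (ζ : ℂ) : ℂ := ∑' n, (weight n * b n : ℝ) / (ζ + (b n ^ 2 : ℝ))

theorem denom_ge (hb : ∀ n, 100 ≤ weight n * b n) (n : ℕ) {s : ℝ} (hs : -5 < s) :
    b n * 100 ≤ s + b n ^ 2 := by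
  nlinarith [le_of_hundred_le hb n]

theorem denom_pos (hb : ∀ n, 100 ≤ weight n * b n) (n : ℕ) {s : ℝ} (hs : -5 < s) :
    0 < s + b n ^ 2 := by
  linarith [denom_ge hb n hs, le_of_hundred_le hb n]

theorem quot_le (hb : ∀ n, 100 ≤ weight n * b n) (n : ℕ) {s : ℝ} (hs : -5 < s) :
    b n / (s + b n ^ 2) ≤ 1 / 100 := by
  rw [div_le_iff₀ (denom_pos hb n hs)]
  linarith [denom_ge hb n hs]

theorem quot_pos (hb : ∀ n, 100 ≤ weight n * b n) (n : ℕ) {s : ℝ} (hs : -5 < s) :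
    0 < b n / (s + b n ^ 2) :=
  div_pos (by linarith [le_of_hundred_le hb n]) (denom_pos hb n hs)

theorem term_pos (hb : ∀ n, 100 ≤ weight n * b n) (n : ℕ) {s : ℝ} (hs : -5 < s) :
    0 < weight n * b n / (s + b n ^ 2) := by
  rw [mul_div_assoc]
  exact mul_pos (weight_pos n) (quot_pos hb n hs)

theorem term_le (hb : ∀ n, 100 ≤ weight n * b n) (n : ℕ) {s : ℝ} (hs : -5 < s) :
    weight n * b n / (s + b n ^ 2) ≤ weight n * (1 / 100) := by
  rw [mul_div_assoc]
  exact mul_le_mul_of_nonneg_left (quot_le hb n hs) (weight_pos n).le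

theorem summable_term (hb : ∀ n, 100 ≤ weight n * b n) {s : ℝ} (hs : -5 < s) :
    Summable fun n => weight n * b n / (s + b n ^ 2) :=
  Summable.of_nonneg_of_le (fun n => (term_pos hb n hs).le) (fun n => term_le hb n hs)
    (hasSum_weight.summable.mul_right _)

theorem term_le_speed (hb : ∀ n, 100 ≤ weight n * b n) (n : ℕ) {s : ℝ} (hs : -5 < s) :
    weight n * b n / (s + b n ^ 2) ≤ speed b s :=
  (summable_term hb hs).le_tsum n fun m _ => (term_pos hb m hs).le

theorem speed_pos (hb : ∀ n, 100 ≤ weight n * b n) {s : ℝ} (hs : -5 < s) : 0 < speed b s :=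
  (term_pos hb 0 hs).trans_le (term_le_speed hb 0 hs)

theorem speed_le (hb : ∀ n, 100 ≤ weight n * b n) {s : ℝ} (hs : -5 < s) :
    speed b s ≤ 1 / 100 := by
  have := (summable_term hb hs).tsum_le_tsum (fun n => term_le hb n hs)
    (hasSum_weight.summable.mul_right _)
  rwa [tsum_mul_right, hasSum_weight.tsum_eq, one_mul] at this

theorem tendsto_speed (hb : ∀ n, 100 ≤ weight n * b n) : Tendsto (speed b) atTop (𝓝 0) := by
  have := tendsto_tsum_of_dominated_convergence (𝓕 := atTop)
    (f := fun (s : ℝ) n => weight n * b n / (s + b n ^ 2)) (g := fun _ => 0)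
    (bound := fun n => weight n * (1 / 100)) (hasSum_weight.summable.mul_right _)
    (fun n => (tendsto_const_nhds (x := weight n * b n)).div_atTop
      (tendsto_atTop_add_const_right _ _ tendsto_id)) ?_
  · rw [tsum_zero] at this
    exact this
  · filter_upwards [eventually_gt_atTop (-5)] with s hs n
    rw [Real.norm_of_nonneg (term_pos hb n hs).le]
    exact term_le hb n hs

theorem weight_mul_quot_sq_le (hb : ∀ n, 100 ≤ weight n * b n) (n : ℕ) {s : ℝ} (hs : -5 < s) :
    weight n * (b n / (s + b n ^ 2)) ^ 2 ≤ weight n := by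
  have h1 := quot_le hb n hs
  have h2 := quot_pos hb n hs
  have h3 := weight_pos n
  have : (b n / (s + b n ^ 2)) ^ 2 ≤ 1 := pow_le_one₀ h2.le (by linarith)
  nlinarith

theorem hasDerivAt_tsum_div (hb : ∀ n, 100 ≤ weight n * b n) {c : ℕ → ℝ}
    (hc : ∀ n, 0 ≤ c n) (hc' : ∀ n, c n ≤ weight n * b n ^ 2) {s : ℝ} (hs : -5 < s) :
    HasDerivAt (fun s => ∑' n, c n / (s + b n ^ 2)) (∑' n, -(c n / (s + b n ^ 2) ^ 2)) s := by
  refine hasDerivAt_tsum_of_isPreconnected (u := weight) (t := Ioi (-5 : ℝ)) (y₀ := 0)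
    (g := fun n (s : ℝ) => c n / (s + b n ^ 2))
    (g' := fun n (s : ℝ) => -(c n / (s + b n ^ 2) ^ 2))
    hasSum_weight.summable isOpen_Ioi isPreconnected_Ioi (fun n y hy => ?_) (fun n y hy => ?_)
    (by norm_num) ?_ hs
  · have := denom_pos hb n hy
    have h1 := ((hasDerivAt_id y).add_const (b n ^ 2)).inv this.ne'
    refine (h1.const_mul (c n)).congr_deriv ?_
    simp
    ring
  · have := denom_pos hb n hy
    rw [norm_neg, Real.norm_of_nonneg (div_nonneg (hc n) (by positivity))]
    refine le_trans ?_ (weight_mul_quot_sq_le hb n hy)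
    rw [div_pow, ← mul_div_assoc]
    gcongr
    exact hc' n
  · refine Summable.of_nonneg_of_le (fun n => ?_) (fun n => ?_) hasSum_weight.summable
    · have := denom_pos hb n (s := 0) (by norm_num)
      exact div_nonneg (hc n) this.le
    · have := denom_pos hb n (s := 0) (by norm_num)
      rw [div_le_iff₀ this, zero_add]
      exact hc' n

theorem summable_div_sq (hb : ∀ n, 100 ≤ weight n * b n) {c : ℕ → ℝ}
    (hc : ∀ n, 0 ≤ c n) (hc' : ∀ n, c n ≤ weight n * b n ^ 2) {s : ℝ} (hs : -5 < s) :
    Summable fun n => c n / (s + b n ^ 2) ^ 2 := by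
  refine Summable.of_nonneg_of_le (fun n => div_nonneg (hc n) (by positivity)) (fun n => ?_)
    hasSum_weight.summable
  have := denom_pos hb n hs
  refine le_trans ?_ (weight_mul_quot_sq_le hb n hs)
  rw [div_pow, ← mul_div_assoc]
  gcongr
  exact hc' n

theorem weight_mul_le (hb : ∀ n, 100 ≤ weight n * b n) (n : ℕ) :
    weight n * b n ≤ weight n * b n ^ 2 := by
  nlinarith [weight_pos n, le_of_hundred_le hb n, hb n]

theorem deriv_speed (hb : ∀ n, 100 ≤ weight n * b n) {s : ℝ} (hs : -5 < s) :
    HasDerivAt (speed b) (∑' n, -(weight n * b n / (s + b n ^ 2) ^ 2)) s ∧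
      (∑' n, -(weight n * b n / (s + b n ^ 2) ^ 2)) ≤ 0 ∧
      -(speed b s ^ 2 / 100) ≤ ∑' n, -(weight n * b n / (s + b n ^ 2) ^ 2) := by
  have hc : ∀ n, 0 ≤ weight n * b n := fun n => by linarith [hb n]
  refine ⟨hasDerivAt_tsum_div hb hc (weight_mul_le hb) hs, ?_, ?_⟩
  · exact tsum_nonpos fun n => neg_nonpos.2 (div_nonneg (hc n) (by positivity))
  · rw [tsum_neg, neg_le_neg_iff]
    have h1 : ∀ n, weight n * b n / (s + b n ^ 2) ^ 2
        ≤ weight n * b n / (s + b n ^ 2) * (speed b s / 100) := by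
      intro n
      have hd := denom_pos hb n hs
      have h2 := term_le_speed hb n hs
      have h3 := term_pos hb n hs
      have h4 : 1 / (s + b n ^ 2) ≤ speed b s / 100 := by
        have : 100 / (s + b n ^ 2) ≤ weight n * b n / (s + b n ^ 2) := by
          gcongr
          exact hb n
        have e : 1 / (s + b n ^ 2) = 100 / (s + b n ^ 2) / 100 := by ring
        rw [e]
        linarith
      have e : weight n * b n / (s + b n ^ 2) ^ 2
          = weight n * b n / (s + b n ^ 2) * (1 / (s + b n ^ 2)) := by
        rw [div_mul_div_comm, mul_one, sq]
      rw [e]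
      gcongr
    refine ((summable_div_sq hb hc (weight_mul_le hb) hs).tsum_le_tsum h1
      ((summable_term hb hs).mul_right _)).trans (le_of_eq ?_)
    rw [tsum_mul_right, ← speed]
    ring

/-- The Jensen inequality for the weights. -/
theorem speed_sq_le (hb : ∀ n, 100 ≤ weight n * b n) {s : ℝ} (hs : -5 < s) :
    speed b s ^ 2 ≤ ∑' n, weight n * b n ^ 2 / (s + b n ^ 2) ^ 2 := by
  have hS := summable_div_sq hb (c := fun n => weight n * b n ^ 2)
    (fun n => mul_nonneg (weight_pos n).le (sq_nonneg _)) (fun n => le_rfl) hs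
  have h1 : 0 ≤ ∑' n, (weight n * b n ^ 2 / (s + b n ^ 2) ^ 2
      - weight n * b n / (s + b n ^ 2) * (2 * speed b s) + weight n * speed b s ^ 2) := by
    refine tsum_nonneg fun n => ?_
    have e : weight n * b n ^ 2 / (s + b n ^ 2) ^ 2
      - weight n * b n / (s + b n ^ 2) * (2 * speed b s) + weight n * speed b s ^ 2
      = weight n * (b n / (s + b n ^ 2) - speed b s) ^ 2 := by
      rw [sub_sq, div_pow]
      ring
    rw [e]
    exact mul_nonneg (weight_pos n).le (sq_nonneg _)
  rw [(hS.sub ((summable_term hb hs).mul_right _)).tsum_add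
    (hasSum_weight.summable.mul_right _), hS.tsum_sub ((summable_term hb hs).mul_right _),
    tsum_mul_right, tsum_mul_right, hasSum_weight.tsum_eq, ← speed] at h1
  linarith

theorem cspeed_ofReal (b : ℕ → ℝ) (s : ℝ) : cspeed b s = speed b s := by
  rw [cspeed, speed, ofReal_tsum]
  refine tsum_congr fun n => ?_
  push_cast
  rfl

theorem norm_cterm_le (hb : ∀ n, 100 ≤ weight n * b n) (n : ℕ) {ζ : ℂ} (hζ : -5 < ζ.re) :
    ‖((weight n * b n : ℝ) : ℂ) / (ζ + (b n ^ 2 : ℝ))‖ ≤ weight n := by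
  have h1 := denom_pos hb n hζ
  have h2 : ζ.re + b n ^ 2 ≤ ‖ζ + ((b n ^ 2 : ℝ) : ℂ)‖ := by
    refine le_trans (le_of_eq ?_) (Complex.re_le_norm _)
    rw [add_re, ofReal_re]
  rw [norm_div, Complex.norm_real, Real.norm_of_nonneg (by linarith [hb n])]
  calc _ ≤ weight n * b n / (ζ.re + b n ^ 2) := by
        have := hb n
        gcongr
    _ ≤ weight n * (1 / 100) := term_le hb n hζ
    _ ≤ weight n := by linarith [weight_pos n]

theorem differentiableOn_cspeed (hb : ∀ n, 100 ≤ weight n * b n) :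
    DifferentiableOn ℂ (cspeed b) {ζ : ℂ | -5 < ζ.re} := by
  refine differentiableOn_tsum_of_summable_norm hasSum_weight.summable (fun n => ?_)
    (isOpen_lt continuous_const continuous_re) (fun n ζ hζ => norm_cterm_le hb n hζ)
  refine (differentiableOn_const _).div (differentiableOn_id.add_const _) fun ζ hζ h0 => ?_
  have h1 := denom_pos hb n (s := ζ.re) hζ
  have := congrArg re h0
  simp only [add_re, ofReal_re, zero_re] at this
  linarith

theorem norm_cspeed_sub_le (hb : ∀ n, 100 ≤ weight n * b n) {s : ℝ} (hs : -1 < s) {ζ : ℂ}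
    (hζ : ‖ζ - s‖ ≤ 2) : ‖cspeed b ζ - speed b s‖ ≤ speed b s / 100 := by
  have hre : -5 < ζ.re := by
    have := (abs_le.1 ((Complex.abs_re_le_norm (ζ - s)).trans hζ)).1
    simp at this
    linarith
  have hs' : -5 < s := by linarith
  have hsum : ∀ {ξ : ℂ}, -5 < ξ.re →
      Summable fun n => ((weight n * b n : ℝ) : ℂ) / (ξ + (b n ^ 2 : ℝ)) := fun hξ =>
    Summable.of_norm_bounded hasSum_weight.summable fun n => norm_cterm_le hb n hξ
  rw [← cspeed_ofReal, cspeed, cspeed, ← (hsum hre).tsum_sub (hsum (by simpa using hs'))]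
  have hS := (summable_term hb hs').div_const 100
  refine tsum_of_norm_bounded (f := fun n => ((weight n * b n : ℝ) : ℂ) / (ζ + (b n ^ 2 : ℝ)) -
    ((weight n * b n : ℝ) : ℂ) / ((s : ℂ) + (b n ^ 2 : ℝ)))
    (g := fun n => weight n * b n / (s + b n ^ 2) / 100) ?_ fun n => ?_
  · have := (summable_term hb hs').hasSum.div_const 100
    exact this
  · have hd := denom_pos hb n hs'
    have hb' := le_of_hundred_le hb n
    have hn : 200 ≤ ‖ζ + ((b n ^ 2 : ℝ) : ℂ)‖ := by
      refine le_trans ?_ (Complex.re_le_norm _)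
      rw [add_re, ofReal_re]
      nlinarith
    have n0 : ζ + ((b n ^ 2 : ℝ) : ℂ) ≠ 0 := norm_pos_iff.1 (by linarith)
    have n1 : (s : ℂ) + ((b n ^ 2 : ℝ) : ℂ) ≠ 0 := by exact_mod_cast hd.ne'
    have e : ((weight n * b n : ℝ) : ℂ) / (ζ + (b n ^ 2 : ℝ)) -
        ((weight n * b n : ℝ) : ℂ) / ((s : ℂ) + (b n ^ 2 : ℝ))
        = ((weight n * b n / (s + b n ^ 2) : ℝ) : ℂ) * (-(ζ - s) / (ζ + (b n ^ 2 : ℝ))) := by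
      rw [div_sub_div _ _ n0 n1]
      push_cast at *
      field_simp
      ring
    rw [e, norm_mul, Complex.norm_real, Real.norm_of_nonneg (term_pos hb n hs').le, norm_div,
      norm_neg, div_eq_mul_one_div _ (100 : ℝ)]
    refine mul_le_mul_of_nonneg_left ?_ (term_pos hb n hs').le
    rw [div_le_iff₀ (by linarith)]
    linarith

end Construction

/-- A slow spiral whose abscissa decays slower than each of the functions
`3/8 (βₙ bₙ)² / (s + bₙ²)`. -/
theorem exists_isSlowSpiral {b : ℕ → ℝ} (hb : ∀ n, 100 ≤ weight n * b n) :
    ∃ (V F : ℂ → ℂ) (v X Y : ℝ → ℝ), IsSlowSpiral V F v X Y ∧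
      ∀ n s, -1 < s → 3 / 8 * (weight n * b n) ^ 2 / (s + b n ^ 2) ≤ X s := by
  have hd : DifferentiableOn ℂ (fun ζ => I * cspeed b ζ - (3 / 8) * cspeed b ζ ^ 2)
      {ζ : ℂ | -5 < ζ.re} :=
    ((differentiableOn_cspeed hb).const_mul _).sub
      (((differentiableOn_cspeed hb).pow 2).const_mul _)
  obtain ⟨P, hP⟩ := (convex_halfSpace_re_gt (-5)).exists_forall_hasDerivWithinAt hd
  have hP' : ∀ ζ : ℂ, -5 < ζ.re →
      HasDerivAt P (I * cspeed b ζ - (3 / 8) * cspeed b ζ ^ 2) ζ := fun ζ hζ =>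
    (hP ζ hζ).hasDerivAt ((isOpen_lt continuous_const continuous_re).mem_nhds hζ)
  have hre : ∀ s : ℝ, -5 < s → HasDerivAt (fun s : ℝ => (P s).re) (-(3 / 8) * speed b s ^ 2) s := by
    intro s hs
    refine ((hP' s (by simpa using hs)).real_of_complex).congr_deriv ?_
    rw [cspeed_ofReal]
    norm_num [← ofReal_pow]
  have him : ∀ s : ℝ, -5 < s → HasDerivAt (fun s : ℝ => (P s).im) (speed b s) s := by
    intro s hs
    have := (((hP' s (by simpa using hs)).const_mul (-I)).real_of_complex)
    simp only [neg_mul, neg_re, I_mul_re, neg_neg] at this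
    refine this.congr_deriv ?_
    rw [cspeed_ofReal]
    norm_num [← ofReal_pow]
  have hanti : AntitoneOn (fun s : ℝ => (P s).re) (Ioi (-5)) := by
    have := monotoneOn_Ioi_of_hasDerivAt (fun s hs => (hre s hs).neg)
      (fun s _ => by linarith [sq_nonneg (speed b s)])
    intro s hs t ht hst
    simpa using this hs ht hst
  have hG : ∀ s : ℝ, -5 < s → HasDerivAt (fun s => ∑' n, weight n * b n ^ 2 / (s + b n ^ 2))
      (∑' n, -(weight n * b n ^ 2 / (s + b n ^ 2) ^ 2)) s := fun s hs =>
    hasDerivAt_tsum_div hb (fun n => mul_nonneg (weight_pos n).le (sq_nonneg _))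
      (fun n => le_rfl) hs
  have hbdd : ∀ s : ℝ, 0 ≤ s →
      (P (0 : ℝ)).re - 3 / 8 * ∑' n, weight n * b n ^ 2 / (0 + b n ^ 2) ≤ (P s).re := by
    intro s hs
    have := monotoneOn_Ioi_of_hasDerivAt
      (fun s hs => (hre s hs).sub ((hG s hs).const_mul (3 / 8)))
      (fun s hs => by
        rw [tsum_neg]
        linarith [speed_sq_le hb hs]) (show (0 : ℝ) ∈ Ioi (-5) by norm_num)
      (show s ∈ Ioi (-5 : ℝ) from lt_of_lt_of_le (by norm_num) hs) hs
    simp only [Pi.sub_apply] at this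
    have hpos : 0 ≤ ∑' n, weight n * b n ^ 2 / (s + b n ^ 2) := tsum_nonneg fun n =>
      div_nonneg (mul_nonneg (weight_pos n).le (sq_nonneg _)) (denom_pos hb n (by linarith)).le
    linarith
  obtain ⟨ℓ, hℓ⟩ : ∃ ℓ, Tendsto (fun s : ℝ => (P s).re) atTop (𝓝 ℓ) := by
    have hanti' : Antitone fun s : ℝ => (P (max s 0 : ℝ)).re := fun s t hst =>
      hanti (lt_of_lt_of_le (by norm_num) (le_max_right s 0))
        (lt_of_lt_of_le (by norm_num) (le_max_right t 0)) (max_le_max_right 0 hst)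
    have hbelow : BddBelow (range fun s : ℝ => (P (max s 0 : ℝ)).re) := by
      refine ⟨(P (0 : ℝ)).re - 3 / 8 * ∑' n, weight n * b n ^ 2 / (0 + b n ^ 2), ?_⟩
      rintro _ ⟨s, rfl⟩
      exact hbdd _ (le_max_right s 0)
    refine ⟨_, (tendsto_atTop_ciInf hanti' hbelow).congr' ?_⟩
    filter_upwards [eventually_ge_atTop 0] with s hs
    rw [max_eq_left hs]
  have hX : ∀ s : ℝ, -5 < s →
      HasDerivAt (fun s : ℝ => (P s).re - ℓ) (-(3 / 8) * speed b s ^ 2) s := fun s hs =>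
    (hre s hs).sub_const ℓ
  have hX0 : Tendsto (fun s : ℝ => (P s).re - ℓ) atTop (𝓝 0) := by
    simpa using hℓ.sub_const ℓ
  refine ⟨cspeed b, fun ζ => P ζ - ℓ, speed b, fun s => (P s).re - ℓ, fun s => (P s).im,
    ⟨?_, ?_, ?_, ?_, ?_, ?_, ?_, ?_, hX0, ?_, tendsto_speed hb⟩, ?_⟩
  · intro ζ hζ
    exact (hP' ζ hζ).sub_const _
  · intro s
    apply Complex.ext <;> simp
  · exact fun s hs => speed_pos hb (by linarith)
  · exact fun s hs => speed_le hb (by linarith)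
  · exact fun s hs ζ hζ => norm_cspeed_sub_le hb hs hζ
  · exact fun s hs => hX s (by linarith)
  · exact fun s hs => him s (by linarith)
  · exact ⟨_, fun s hs => deriv_speed hb (by linarith)⟩
  · have hmono := monotoneOn_Ioi_of_hasDerivAt (a := -5)
      (f := fun s => (P (s : ℝ)).im - weight 0 * b 0 * Real.log (s + b 0 ^ 2))
      (f' := fun s => speed b s - weight 0 * b 0 * (1 / (s + b 0 ^ 2)))
      (fun s hs => (him s hs).sub
        ((((hasDerivAt_id s).add_const (b 0 ^ 2)).log (denom_pos hb 0 hs).ne').const_mul _))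
      (fun s hs => by
        have := term_le_speed hb 0 hs
        rw [mul_one_div]
        linarith)
    have hlog : Tendsto (fun s => (P (0 : ℝ)).im - weight 0 * b 0 * Real.log (0 + b 0 ^ 2)
        + weight 0 * b 0 * Real.log (s + b 0 ^ 2)) atTop atTop :=
      tendsto_atTop_add_const_left _ _ ((Real.tendsto_log_atTop.comp
        (tendsto_atTop_add_const_right _ _ tendsto_id)).const_mul_atTop (by linarith [hb 0]))
    refine tendsto_atTop_mono' _ ?_ hlog
    filter_upwards [eventually_ge_atTop 0] with s hs
    have := hmono (show (0 : ℝ) ∈ Ioi (-5) by norm_num)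
      (show s ∈ Ioi (-5 : ℝ) from lt_of_lt_of_le (by norm_num) hs) hs
    simp only at this
    linarith
  · intro n s hs
    have hQ : ∀ s : ℝ, -5 < s → HasDerivAt (fun s => 3 / 8 * (weight n * b n) ^ 2 / (s + b n ^ 2))
        (-(3 / 8) * (weight n * b n / (s + b n ^ 2)) ^ 2) s := by
      intro s hs
      have h1 := ((hasDerivAt_id s).add_const (b n ^ 2)).inv (denom_pos hb n hs).ne'
      refine (h1.const_mul (3 / 8 * (weight n * b n) ^ 2)).congr_deriv ?_
      rw [div_pow]
      simp
      ring
    have hmono := monotoneOn_Ioi_of_hasDerivAt (fun s hs => (hQ s hs).sub (hX s hs))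
      (fun s hs => by
        have h1 := term_le_speed hb n hs
        have h2 := term_pos hb n hs
        have : (weight n * b n / (s + b n ^ 2)) ^ 2 ≤ speed b s ^ 2 := by gcongr
        linarith)
    have hlim : Tendsto (fun s => 3 / 8 * (weight n * b n) ^ 2 / (s + b n ^ 2) - ((P (s : ℝ)).re - ℓ))
        atTop (𝓝 (0 - 0)) :=
      ((tendsto_const_nhds (x := 3 / 8 * (weight n * b n) ^ 2)).div_atTop
        (tendsto_atTop_add_const_right _ _ tendsto_id)).sub hX0
    have hs5 : -5 < s := by linarith
    have := ge_of_tendsto hlim (b := 3 / 8 * (weight n * b n) ^ 2 / (s + b n ^ 2)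
      - ((P (s : ℝ)).re - ℓ)) (by
        filter_upwards [eventually_ge_atTop s] with t ht
        exact hmono hs5 (hs5.trans_le ht) ht)
    linarith

/-- A chord of the circle is at least `4` times the normalized arc. -/
theorem four_mul_norm_le_norm_one_sub_toCircle (θ : AddCircle (1 : ℝ)) :
    4 * ‖θ‖ ≤ ‖1 - (AddCircle.toCircle θ : ℂ)‖ := by
  obtain ⟨x, hx, rfl⟩ : ∃ x : ℝ, |x| ≤ 1 / 2 ∧ (x : AddCircle (1 : ℝ)) = θ := by
    induction θ using QuotientAddGroup.induction_on with
    | H y =>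
      refine ⟨y - round y, abs_sub_round y, ?_⟩
      rw [AddCircle.coe_sub]
      have : ((round y : ℝ) : AddCircle (1 : ℝ)) = 0 :=
        (AddCircle.coe_eq_zero_iff 1).2 ⟨round y, by simp⟩
      rw [this, sub_zero]
  have h1 : ‖(x : AddCircle (1 : ℝ))‖ ≤ |x| :=
    QuotientAddGroup.norm_mk_le_norm
  have h2 : ‖1 - (AddCircle.toCircle (x : AddCircle (1 : ℝ)) : ℂ)‖ = 2 * |Real.sin (Real.pi * x)| := by
    rw [AddCircle.toCircle_apply_mk, Circle.coe_exp, norm_sub_rev, mul_comm _ I,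
      Complex.norm_exp_I_mul_ofReal_sub_one, norm_mul, Real.norm_eq_abs, Real.norm_eq_abs]
    norm_num
    congr 2
    ring
  have h3 : 2 * |x| ≤ |Real.sin (Real.pi * x)| := by
    have hpi := Real.pi_pos
    have hab : |Real.pi * x| = Real.pi * |x| := by rw [abs_mul, abs_of_pos hpi]
    have := Real.mul_abs_le_abs_sin (x := Real.pi * x) (by rw [hab]; nlinarith)
    rw [hab] at this
    refine le_trans (le_of_eq ?_) this
    field_simp
  rw [h2]
  linarith

theorem volume_setOf_norm_one_sub_toCircle_le {ε : ℝ} (hε : 0 ≤ ε) :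
    volume {θ : AddCircle (1 : ℝ) | ‖1 - (AddCircle.toCircle θ : ℂ)‖ ≤ ε} ≤ ENNReal.ofReal ε := by
  have hsub : {θ : AddCircle (1 : ℝ) | ‖1 - (AddCircle.toCircle θ : ℂ)‖ ≤ ε} ⊆
      Metric.closedBall 0 (ε / 4) := by
    intro θ hθ
    rw [mem_ofPred_eq] at hθ
    rw [mem_closedBall_zero_iff]
    linarith [four_mul_norm_le_norm_one_sub_toCircle θ]
  refine (measure_mono hsub).trans ?_
  rw [AddCircle.volume_closedBall]
  exact ENNReal.ofReal_le_ofReal ((min_le_right _ _).trans (by linarith))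

/-- If `ψ` is close to the unit circle only near the point `1`, then so are its radial limits. -/
theorem norm_one_sub_toCircle_le {ψ : ℂ → ℂ} {h d : ℝ} (hh : 0 < h)
    (hψ : ∀ z ∈ unitDisk, 1 - 2 * h ≤ ‖ψ z‖ → ‖1 - z‖ ≤ d) {θ : AddCircle (1 : ℝ)} {w : ℂ}
    (hw : HasRadialLimit ψ θ w) (hwh : 1 - h ≤ ‖w‖) : ‖1 - (AddCircle.toCircle θ : ℂ)‖ ≤ d := by
  have h1 : ∀ᶠ r : ℝ in 𝓝[<] 1, 1 - 2 * h < ‖ψ (r * (AddCircle.toCircle θ : ℂ))‖ :=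
    (Tendsto.norm hw).eventually_const_lt (by linarith)
  have h2 : Tendsto (fun r : ℝ => ‖1 - (r : ℂ) * (AddCircle.toCircle θ : ℂ)‖) (𝓝[<] 1)
      (𝓝 ‖1 - (AddCircle.toCircle θ : ℂ)‖) := by
    have : Continuous fun r : ℝ => ‖1 - (r : ℂ) * (AddCircle.toCircle θ : ℂ)‖ := by fun_prop
    simpa using (this.tendsto 1).mono_left nhdsWithin_le_nhds
  refine le_of_tendsto h2 ?_
  filter_upwards [h1, Ioo_mem_nhdsLT (show (0 : ℝ) < 1 by norm_num)] with r hr hr1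
  refine hψ _ ?_ hr.le
  rw [mem_unitDisk, norm_mul, Circle.norm_coe, mul_one, Complex.norm_real,
    Real.norm_of_nonneg hr1.1.le]
  exact hr1.2

/-- For every sequence `d` there is a surjective four-valent symbol that is within `2h` of the
unit circle only at points within `d n` of `1`, as soon as `h < 3/128 * weight n ^ 2`. -/
theorem exists_symbol_of_sequence {d : ℕ → ℝ} (hd : ∀ n, 0 < d n) :
    ∃ ψ : ℂ → ℂ, IsSymbol ψ ∧ ψ '' unitDisk = unitDisk ∧ Valent ψ 4 ∧
      ∀ n h, 0 < h → h < 3 / 128 * weight n ^ 2 →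
        ∀ z ∈ unitDisk, 1 - 2 * h ≤ ‖ψ z‖ → ‖1 - z‖ ≤ d n := by
  let b : ℕ → ℝ := fun n => 100 / weight n + |Real.log (d n)|
  have hb : ∀ n, 100 ≤ weight n * b n := fun n => by
    have h1 := weight_pos n
    have h2 : weight n * b n = 100 + weight n * |Real.log (d n)| := by
      simp only [b]
      field_simp
    rw [h2]
    exact le_add_of_nonneg_right (mul_nonneg h1.le (abs_nonneg _))
  obtain ⟨V, F, v, X, Y, hS, hX⟩ := exists_isSlowSpiral hb
  obtain ⟨ψ, h1, h2, h3, h4⟩ := hS.exists_symbol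
  refine ⟨ψ, h1, h2, h3, fun n h hh hn z hz hψ => ?_⟩
  have hw := weight_pos n
  have hw2 := weight_le_half n
  have h14 : h ≤ 1 / 4 := by nlinarith
  have hs := neg_log_one_sub_mem hz
  have hz1 : 0 < ‖1 - z‖ := by
    have := one_sub_re_pos hz
    exact this.trans_le (Complex.re_le_norm _)
  set s := -Real.log ‖1 - z‖ with hsdef
  have hs1 : -1 < s := by
    rw [hsdef]
    have := hs.1
    simp [Complex.log_re] at this
    linarith
  have hXs : X s < 3 / 16 * weight n ^ 2 := by
    have e1 : Real.exp (-(4 * h)) ≤ 1 - 2 * h := by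
      have := Real.add_one_le_exp (4 * h)
      rw [Real.exp_neg, inv_le_comm₀ (Real.exp_pos _) (by linarith)]
      refine le_trans ?_ this
      rw [inv_le_iff_one_le_mul₀ (by linarith)]
      nlinarith
    have e2 := Real.exp_le_exp.1 ((e1.trans hψ).trans (h4 z hz))
    linarith
  have hbs : b n ^ 2 < s := by
    by_contra! hc
    have hpos : 0 < s + b n ^ 2 := denom_pos hb n (by linarith)
    have := hX n s hs1
    have h5 : 3 / 16 * weight n ^ 2 ≤ 3 / 8 * (weight n * b n) ^ 2 / (s + b n ^ 2) := by
      rw [le_div_iff₀ hpos, mul_pow]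
      nlinarith [sq_nonneg (weight n)]
    linarith
  have hb1 : 200 ≤ b n := le_of_hundred_le hb n
  have hlog : -Real.log (d n) ≤ b n := by
    have : 0 < 100 / weight n := by positivity
    have := neg_le_abs (Real.log (d n))
    simp only [b]
    linarith
  rw [← Real.log_le_log_iff hz1 (hd n)]
  nlinarith

/-- for every non-decreasing `δ : (0,1) → (0,1)` there is a surjective
four-valent symbol `ψ` and `h₀ ∈ (0,1)` with `m({|ψ*| ≥ 1 - h}) ≤ δ(h)` for
`0 < h ≤ h₀`. -/
theorem stmt_10 (δ : ℝ → ℝ) (hδmem : ∀ h ∈ Set.Ioo (0 : ℝ) 1, δ h ∈ Set.Ioo (0 : ℝ) 1)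
    (hδmono : MonotoneOn δ (Set.Ioo (0 : ℝ) 1)) :
    ∃ ψ : ℂ → ℂ, IsSymbol ψ ∧ ψ '' unitDisk = unitDisk ∧ Valent ψ 4 ∧
      ∃ h₀ ∈ Set.Ioo (0 : ℝ) 1, ∀ h : ℝ, 0 < h → h ≤ h₀ →
        volume {θ : AddCircle (1 : ℝ) | ∃ w : ℂ, HasRadialLimit ψ θ w ∧ 1 - h ≤ ‖w‖}
          ≤ ENNReal.ofReal (δ h) := by
  have hmem : ∀ n, 3 / 128 * weight n ^ 2 ∈ Ioo (0 : ℝ) 1 := fun n => by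
    have h1 := weight_pos n
    have h2 := weight_le_half n
    exact ⟨by positivity, by nlinarith⟩
  obtain ⟨ψ, h1, h2, h3, h4⟩ :=
    exists_symbol_of_sequence fun n => (hδmem _ (hmem (n + 1))).1
  refine ⟨ψ, h1, h2, h3, 1 / 1000, by norm_num, fun h hh hle => ?_⟩
  have hh1 : h ∈ Ioo (0 : ℝ) 1 := ⟨hh, by linarith⟩
  obtain ⟨n, hn1, hn2⟩ :
      ∃ n, 3 / 128 * weight (n + 1) ^ 2 ≤ h ∧ h < 3 / 128 * weight n ^ 2 := by
    have hex : ∃ n, 3 / 128 * weight n ^ 2 ≤ h := by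
      have := ((hasSum_weight.summable.tendsto_atTop_zero.pow 2).const_mul (3 / 128))
      norm_num at this
      exact (this.eventually_le_const hh).exists
    classical
    have h0 : Nat.find hex ≠ 0 := fun h0 => by
      have := Nat.find_spec hex
      rw [h0] at this
      norm_num [weight] at this
      linarith
    obtain ⟨n, hn⟩ := Nat.exists_eq_succ_of_ne_zero h0
    have hspec := Nat.find_spec hex
    rw [hn] at hspec
    refine ⟨n, hspec, not_le.1 (Nat.find_min hex ?_)⟩
    omega
  refine le_trans (measure_mono ?_)
    (volume_setOf_norm_one_sub_toCircle_le (hδmem h hh1).1.le)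
  rintro θ ⟨w, hw, hwh⟩
  exact (norm_one_sub_toCircle_le hh (h4 n h hh hn2) hw hwh).trans
    (hδmono (hmem (n + 1)) hh1 hn1)

end
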